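/- arXiv:2104.09767 — 4 statements merged into one kernel-verified Lean document; each statement's English description precedes it below -/
import Mathlib

section
/- Let μ be a real constant and let ρ, m, n : ℝ² → ℝ be differentiable at a point x₀ with ρ(x₀) ≠ 0. Define the velocities u = m/ρ and v = n/ρ on the set where ρ ≠ 0. Then the viscous stress vector of the y-momentum equation, (τ₂₁, τ₂₂) := ( μ·(∂₂u(x₀) + ∂₁v(x₀)), μ·(−(2/3)·∂₁u(x₀) + (4/3)·∂₂v(x₀)) ), satisfies the decomposition (τ₂₁, τ₂₂) = A31·∇ρ(x₀) + A32·∇m(x₀) + A33·∇n(x₀), where A31, A32, A33 are evaluated at the point values ρ = ρ(x₀), u = u(x₀), v = v(x₀) and act on the gradient vectors by matrix–vector multiplication. -/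
/-- Partial derivative of `f : ℝ² → ℝ` at `x` in the `i`-th coordinate direction. -/
noncomputable def pd2 (f : (Fin 2 → ℝ) → ℝ) (x : Fin 2 → ℝ) (i : Fin 2) : ℝ :=
  fderiv ℝ f x (Pi.single i 1)

/-- Gradient of `f : ℝ² → ℝ` at `x`. -/
noncomputable def grad2 (f : (Fin 2 → ℝ) → ℝ) (x : Fin 2 → ℝ) : Fin 2 → ℝ :=
  fun i => pd2 f x i

/-- Quotient rule for partial derivatives, in terms of the value of the quotient `w = q / ρ`,
which need only be given where `ρ ≠ 0`. -/
theorem pd2_eq_of_eq_div {ρ q w : (Fin 2 → ℝ) → ℝ} {x₀ : Fin 2 → ℝ}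
    (hρ : DifferentiableAt ℝ ρ x₀) (hq : DifferentiableAt ℝ q x₀) (hρ0 : ρ x₀ ≠ 0)
    (hw : ∀ x, ρ x ≠ 0 → w x = q x / ρ x) (i : Fin 2) :
    pd2 w x₀ i = (pd2 q x₀ i - w x₀ * pd2 ρ x₀ i) / ρ x₀ := by
  have hne : ∀ᶠ x in nhds x₀, ρ x ≠ 0 := hρ.continuousAt.eventually_ne hρ0
  have hwd : DifferentiableAt ℝ w x₀ :=
    (hq.fun_mul (hρ.fun_inv hρ0)).congr_of_eventuallyEq
      (hne.mono fun x hx => (hw x hx).trans (div_eq_mul_inv _ _))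
  have hqw : q =ᶠ[nhds x₀] fun x => w x * ρ x :=
    hne.mono fun x hx => by simp only [hw x hx, div_mul_cancel₀ _ hx]
  have hmul : pd2 q x₀ i = w x₀ * pd2 ρ x₀ i + ρ x₀ * pd2 w x₀ i := by
    simp [pd2, hqw.fderiv_eq, fderiv_fun_mul hwd hρ]
  rw [hmul, add_sub_cancel_left, mul_div_cancel_left₀ _ hρ0]

/-- The viscous stress vector `(τ₂₁, τ₂₂)` of the y-momentum equation of the 2-D
compressible Navier–Stokes equations decomposes as
`A31·∇ρ + A32·∇(ρu) + A33·∇(ρv)` at any point where `ρ ≠ 0`. -/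
theorem yMomentum_viscous_decomposition
    (μ : ℝ) (ρ m n : (Fin 2 → ℝ) → ℝ) (x₀ : Fin 2 → ℝ)
    (hρ : DifferentiableAt ℝ ρ x₀) (hm : DifferentiableAt ℝ m x₀)
    (hn : DifferentiableAt ℝ n x₀) (hρ0 : ρ x₀ ≠ 0)
    (u v : (Fin 2 → ℝ) → ℝ)
    (hu : ∀ x, ρ x ≠ 0 → u x = m x / ρ x)
    (hv : ∀ x, ρ x ≠ 0 → v x = n x / ρ x) :
    ![μ * (pd2 u x₀ 1 + pd2 v x₀ 0),
      μ * (-(2/3) * pd2 u x₀ 0 + (4/3) * pd2 v x₀ 1)]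
    = ((-(μ / ρ x₀)) • !![v x₀, u x₀; -(2/3) * u x₀, (4/3) * v x₀]).mulVec (grad2 ρ x₀)
      + ((μ / ρ x₀) • !![(0 : ℝ), 1; -(2/3), 0]).mulVec (grad2 m x₀)
      + ((μ / ρ x₀) • !![(1 : ℝ), 0; 0, 4/3]).mulVec (grad2 n x₀) := by
  have hpu := pd2_eq_of_eq_div hρ hm hρ0 hu
  have hpv := pd2_eq_of_eq_div hρ hn hρ0 hv
  ext i
  fin_cases i <;>
  · simp [dotProduct, Fin.sum_univ_two, grad2, hpu, hpv]
    ring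
end

section
/- Let μ, γ, Pr be real constants with Pr ≠ 0, and let ρ, m, n, E : ℝ² → ℝ be differentiable at a point x₀ with ρ(x₀) ≠ 0. Define u = m/ρ, v = n/ρ, the internal energy e = E/ρ − (u² + v²)/2, and the stress components τ₁₁ = μ·((4/3)∂₁u − (2/3)∂₂v), τ₁₂ = τ₂₁ = μ·(∂₂u + ∂₁v), τ₂₂ = μ·(−(2/3)∂₁u + (4/3)∂₂v), all evaluated at x₀. Then the viscous flux vector of the energy equation, ( u·τ₁₁ + v·τ₂₁ + (μγ/Pr)·∂₁e, u·τ₁₂ + v·τ₂₂ + (μγ/Pr)·∂₂e ) at x₀, equals A41·∇ρ(x₀) + A42·∇m(x₀) + A43·∇n(x₀) + A44·∇E(x₀), where A41, A42, A43, A44 are evaluated at the point values ρ = ρ(x₀), u = u(x₀), v = v(x₀), e = e(x₀) and act on the gradient vectors by matrix–vector multiplication. -/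
/-- A function that agrees with a quotient wherever the denominator is nonzero is differentiable
where the numerator and the denominator are and the latter does not vanish. -/
theorem differentiableAt_of_eq_div {f g q : (Fin 2 → ℝ) → ℝ} {x₀ : Fin 2 → ℝ}
    (hf : DifferentiableAt ℝ f x₀) (hg : DifferentiableAt ℝ g x₀) (hg0 : g x₀ ≠ 0)
    (hq : ∀ x, g x ≠ 0 → q x = f x / g x) : DifferentiableAt ℝ q x₀ :=
  (hf.fun_mul (hg.fun_inv hg0)).congr_of_eventuallyEq
    ((hg.continuousAt.eventually_ne hg0).mono fun x hx => by
      simp only [hq x hx, div_eq_mul_inv])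

/-- Quotient rule for `pd2`, with the quotient written in terms of its value `q x₀`. -/
theorem pd2_of_eq_div {f g q : (Fin 2 → ℝ) → ℝ} {x₀ : Fin 2 → ℝ}
    (hf : DifferentiableAt ℝ f x₀) (hg : DifferentiableAt ℝ g x₀) (hg0 : g x₀ ≠ 0)
    (hq : ∀ x, g x ≠ 0 → q x = f x / g x) (i : Fin 2) :
    pd2 q x₀ i = (pd2 f x₀ i - q x₀ * pd2 g x₀ i) / g x₀ := by
  have hqd := differentiableAt_of_eq_div hf hg hg0 hq
  have hfq : f =ᶠ[nhds x₀] fun x => q x * g x :=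
    (hg.continuousAt.eventually_ne hg0).mono fun x hx => by
      simp only [hq x hx, div_mul_cancel₀ _ hx]
  rw [eq_div_iff hg0]
  simp only [pd2, hfq.fderiv_eq, fderiv_fun_mul hqd hg, add_apply,
    smul_apply, smul_eq_mul]
  ring

/-- Partial derivatives of the internal energy `e = E / ρ - (u² + v²) / 2`. -/
theorem pd2_of_eq_div_sub_kinetic {E ρ u v e : (Fin 2 → ℝ) → ℝ} {x₀ : Fin 2 → ℝ}
    (hE : DifferentiableAt ℝ E x₀) (hρ : DifferentiableAt ℝ ρ x₀) (hρ0 : ρ x₀ ≠ 0)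
    (hu : DifferentiableAt ℝ u x₀) (hv : DifferentiableAt ℝ v x₀)
    (he : ∀ x, ρ x ≠ 0 → e x = E x / ρ x - ((u x) ^ 2 + (v x) ^ 2) / 2) (i : Fin 2) :
    pd2 e x₀ i = (pd2 E x₀ i - E x₀ / ρ x₀ * pd2 ρ x₀ i) / ρ x₀
      - u x₀ * pd2 u x₀ i - v x₀ * pd2 v x₀ i := by
  have hq := pd2_of_eq_div hE hρ hρ0 (q := fun x => E x / ρ x) (fun _ _ => rfl) i
  have heq : e =ᶠ[nhds x₀] fun x => E x / ρ x - (u x * u x + v x * v x) * (1 / 2) :=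
    (hρ.continuousAt.eventually_ne hρ0).mono fun x hx => by
      simp only [he x hx]; ring
  rw [← hq]
  simp only [pd2, heq.fderiv_eq]
  rw [fderiv_fun_sub (differentiableAt_of_eq_div hE hρ hρ0 fun _ _ => rfl)
      (((hu.fun_mul hu).fun_add (hv.fun_mul hv)).mul_const _),
    fderiv_mul_const ((hu.fun_mul hu).fun_add (hv.fun_mul hv)),
    fderiv_fun_add (hu.fun_mul hu) (hv.fun_mul hv), fderiv_fun_mul hu hu, fderiv_fun_mul hv hv]
  simp only [sub_apply, add_apply,
    smul_apply, smul_eq_mul]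
  ring

/-- The viscous flux vector of the energy equation of the 2-D compressible Navier–Stokes
equations decomposes as `A41·∇ρ + A42·∇(ρu) + A43·∇(ρv) + A44·∇E` at any point where
`ρ ≠ 0`. -/
theorem energy_viscous_decomposition
    (μ γ Pr : ℝ) (hPr : Pr ≠ 0)
    (ρ m n E : (Fin 2 → ℝ) → ℝ) (x₀ : Fin 2 → ℝ)
    (hρ : DifferentiableAt ℝ ρ x₀) (hm : DifferentiableAt ℝ m x₀)
    (hn : DifferentiableAt ℝ n x₀) (hE : DifferentiableAt ℝ E x₀)
    (hρ0 : ρ x₀ ≠ 0)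
    (u v e : (Fin 2 → ℝ) → ℝ)
    (hu : ∀ x, ρ x ≠ 0 → u x = m x / ρ x)
    (hv : ∀ x, ρ x ≠ 0 → v x = n x / ρ x)
    (he : ∀ x, ρ x ≠ 0 → e x = E x / ρ x - ((u x) ^ 2 + (v x) ^ 2) / 2)
    (τ11 τ12 τ22 : ℝ)
    (hτ11 : τ11 = μ * ((4/3) * pd2 u x₀ 0 - (2/3) * pd2 v x₀ 1))
    (hτ12 : τ12 = μ * (pd2 u x₀ 1 + pd2 v x₀ 0))
    (hτ22 : τ22 = μ * (-(2/3) * pd2 u x₀ 0 + (4/3) * pd2 v x₀ 1)) :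
    ![u x₀ * τ11 + v x₀ * τ12 + (μ * γ / Pr) * pd2 e x₀ 0,
      u x₀ * τ12 + v x₀ * τ22 + (μ * γ / Pr) * pd2 e x₀ 1]
    = ((μ / ρ x₀) •
        !![(γ / (2 * Pr) - 4/3) * (u x₀) ^ 2 + (γ / (2 * Pr) - 1) * (v x₀) ^ 2
              - (γ / Pr) * e x₀,
            -(1/3) * (u x₀ * v x₀);
           -(1/3) * (u x₀ * v x₀),
            (γ / (2 * Pr) - 1) * (u x₀) ^ 2 + (γ / (2 * Pr) - 4/3) * (v x₀) ^ 2
              - (γ / Pr) * e x₀]).mulVec (grad2 ρ x₀)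
      + ((μ / ρ x₀) •
          !![(4/3 - γ / Pr) * u x₀, v x₀;
             -(2/3) * v x₀, (1 - γ / Pr) * u x₀]).mulVec (grad2 m x₀)
      + ((μ / ρ x₀) •
          !![(1 - γ / Pr) * v x₀, -(2/3) * u x₀;
             u x₀, (4/3 - γ / Pr) * v x₀]).mulVec (grad2 n x₀)
      + ((μ * γ / (ρ x₀ * Pr)) • (1 : Matrix (Fin 2) (Fin 2) ℝ)).mulVec (grad2 E x₀) := by
  have hu' := pd2_of_eq_div hm hρ hρ0 hu
  have hv' := pd2_of_eq_div hn hρ hρ0 hv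
  have he' := pd2_of_eq_div_sub_kinetic hE hρ hρ0 (differentiableAt_of_eq_div hm hρ hρ0 hu)
    (differentiableAt_of_eq_div hn hρ hρ0 hv) he
  have hE0 : E x₀ = ρ x₀ * (e x₀ + (u x₀ ^ 2 + v x₀ ^ 2) / 2) := by
    rw [he x₀ hρ0]; field_simp; ring
  subst hτ11 hτ12 hτ22
  ext i
  fin_cases i <;>
  · simp [dotProduct, Fin.sum_univ_two, grad2, he', hu', hv', hE0]
    field_simp
    ring
end

section
/- Let μ, γ, Pr be real constants with μ ≠ 0 and Pr ≠ 0, and regard A41, A42, A43, A44 as matrix-valued functions of Q ∈ ℝ⁴ via ρ = Q₁, u = Q₂/Q₁, v = Q₃/Q₁, e = Q₄/Q₁ − (u² + v²)/2. Then there exists no function B : ℝ⁴ → M₂(ℝ) that is differentiable on the open set Ω = {Q ∈ ℝ⁴ : Q₁ > 0} and satisfies, for all Q ∈ Ω, the compatibility conditions ∂B/∂Q₁(Q) = A41(Q), ∂B/∂Q₂(Q) = A42(Q), ∂B/∂Q₃(Q) = A43(Q), and ∂B/∂Q₄(Q) = A44(Q). In other words, the matrix antiderivative for the energy equation of the 2-D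 compressible Navier–Stokes viscous terms does not exist. -/
/-- Entrywise partial derivative of a matrix-valued function `B : ℝ⁴ → M₂(ℝ)` at `Q`
in the `k`-th coordinate direction. -/
noncomputable def pd4M (B : (Fin 4 → ℝ) → Matrix (Fin 2) (Fin 2) ℝ)
    (Q : Fin 4 → ℝ) (k : Fin 4) : Matrix (Fin 2) (Fin 2) ℝ :=
  Matrix.of fun i j => fderiv ℝ (fun Q' => B Q' i j) Q (Pi.single k 1)

/-- The energy-equation diffusion matrix `A41`, written in the conserved variables
`ρ = Q₁`, `u = Q₂/Q₁`, `v = Q₃/Q₁`, `e = Q₄/Q₁ − (u² + v²)/2`. -/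
noncomputable def A41 (μ γ Pr : ℝ) (Q : Fin 4 → ℝ) : Matrix (Fin 2) (Fin 2) ℝ :=
  (μ / Q 0) •
    !![(γ / (2 * Pr) - 4/3) * (Q 1 / Q 0) ^ 2 + (γ / (2 * Pr) - 1) * (Q 2 / Q 0) ^ 2
         - (γ / Pr) * (Q 3 / Q 0 - ((Q 1 / Q 0) ^ 2 + (Q 2 / Q 0) ^ 2) / 2),
       -(1/3) * ((Q 1 / Q 0) * (Q 2 / Q 0));
       -(1/3) * ((Q 1 / Q 0) * (Q 2 / Q 0)),
       (γ / (2 * Pr) - 1) * (Q 1 / Q 0) ^ 2 + (γ / (2 * Pr) - 4/3) * (Q 2 / Q 0) ^ 2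
         - (γ / Pr) * (Q 3 / Q 0 - ((Q 1 / Q 0) ^ 2 + (Q 2 / Q 0) ^ 2) / 2)]

/-- The energy-equation diffusion matrix `A42` in the conserved variables. -/
noncomputable def A42 (μ γ Pr : ℝ) (Q : Fin 4 → ℝ) : Matrix (Fin 2) (Fin 2) ℝ :=
  (μ / Q 0) • !![(4/3 - γ / Pr) * (Q 1 / Q 0), Q 2 / Q 0;
                 -(2/3) * (Q 2 / Q 0), (1 - γ / Pr) * (Q 1 / Q 0)]

/-- The energy-equation diffusion matrix `A43` in the conserved variables. -/
noncomputable def A43 (μ γ Pr : ℝ) (Q : Fin 4 → ℝ) : Matrix (Fin 2) (Fin 2) ℝ :=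
  (μ / Q 0) • !![(1 - γ / Pr) * (Q 2 / Q 0), -(2/3) * (Q 1 / Q 0);
                 Q 1 / Q 0, (4/3 - γ / Pr) * (Q 2 / Q 0)]

/-- The energy-equation diffusion matrix `A44` in the conserved variables. -/
noncomputable def A44 (μ γ Pr : ℝ) (Q : Fin 4 → ℝ) : Matrix (Fin 2) (Fin 2) ℝ :=
  (μ * γ / (Q 0 * Pr)) • (1 : Matrix (Fin 2) (Fin 2) ℝ)

/-- A function whose derivative along the line `t ↦ x + t • v` in direction `v` is constantly `c`
increases by `c` from `x` to `x + v`. -/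
theorem apply_add_eq_of_fderiv_line_eq_const {E : Type*} [NormedAddCommGroup E] [NormedSpace ℝ E]
    {f : E → ℝ} {x v : E} {c : ℝ} (hf : ∀ t : ℝ, DifferentiableAt ℝ f (x + t • v))
    (hc : ∀ t : ℝ, fderiv ℝ f (x + t • v) v = c) : f (x + v) = f x + c := by
  have hderiv (t : ℝ) : HasDerivAt (fun s : ℝ => f (x + s • v) - s * c) 0 t := by
    have hline : HasDerivAt (fun s : ℝ => x + s • v) v t := by
      simpa using ((hasDerivAt_id t).smul_const v).const_add x
    have hcomp := (hf t).hasFDerivAt.comp_hasDerivAt t hline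
    rw [hc t] at hcomp
    exact (hcomp.sub ((hasDerivAt_id t).mul_const c)).congr_deriv (by simp)
  have h := is_const_of_deriv_eq_zero (fun t => (hderiv t).differentiableAt)
    (fun t => (hderiv t).deriv) 1 0
  simp only [one_smul, one_mul, zero_smul, zero_mul, add_zero, sub_zero] at h
  linarith

/-- There is no matrix antiderivative `B : ℝ⁴ → M₂(ℝ)`, differentiable on
`Ω = {Q : Q₁ > 0}`, whose partial derivatives reproduce the energy-equation diffusion
matrices `A41, A42, A43, A44` of the 2-D compressible Navier–Stokes equations. -/
theorem energy_antiderivative_not_exists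
    (μ γ Pr : ℝ) (hμ : μ ≠ 0) (hPr : Pr ≠ 0) :
    ¬ ∃ B : (Fin 4 → ℝ) → Matrix (Fin 2) (Fin 2) ℝ,
        (∀ i j : Fin 2,
          DifferentiableOn ℝ (fun Q => B Q i j) {Q : Fin 4 → ℝ | Q 0 > 0}) ∧
        ∀ Q : Fin 4 → ℝ, Q 0 > 0 →
          pd4M B Q 0 = A41 μ γ Pr Q ∧
          pd4M B Q 1 = A42 μ γ Pr Q ∧
          pd4M B Q 2 = A43 μ γ Pr Q ∧
          pd4M B Q 3 = A44 μ γ Pr Q := by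
  rintro ⟨B, hB, hpd⟩
  have hopen : IsOpen {Q : Fin 4 → ℝ | Q 0 > 0} :=
    isOpen_lt continuous_const (continuous_apply 0)
  let f : (Fin 4 → ℝ) → ℝ := fun Q => B Q 0 1
  have hdiff (Q : Fin 4 → ℝ) (hQ : Q 0 > 0) : DifferentiableAt ℝ f Q :=
    (hB 0 1).differentiableAt (hopen.mem_nhds hQ)
  have hx (Q : Fin 4 → ℝ) (hQ : Q 0 > 0) :
      fderiv ℝ f Q (Pi.single 1 1) = μ / Q 0 * (Q 2 / Q 0) := by
    simpa [pd4M, A42] using congrFun (congrFun (hpd Q hQ).2.1 0) 1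
  have hy (Q : Fin 4 → ℝ) (hQ : Q 0 > 0) :
      fderiv ℝ f Q (Pi.single 2 1) = μ / Q 0 * (-(2 / 3) * (Q 1 / Q 0)) := by
    simpa [pd4M, A43] using congrFun (congrFun (hpd Q hQ).2.2.1 0) 1
  -- Compare the two ways around the unit square in the `(Q 1, Q 2)`-plane at `Q 0 = 1`.
  have hstep_x (y : ℝ) : f (![1, 0, y, 0] + Pi.single 1 1) = f ![1, 0, y, 0] + μ * y :=
    apply_add_eq_of_fderiv_line_eq_const (fun t => hdiff _ (by simp))
      (fun t => by rw [hx _ (by simp)]; simp)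
  have hstep_y (x : ℝ) :
      f (![1, x, 0, 0] + Pi.single 2 1) = f ![1, x, 0, 0] + μ * (-(2 / 3) * x) :=
    apply_add_eq_of_fderiv_line_eq_const (fun t => hdiff _ (by simp))
      (fun t => by rw [hy _ (by simp)]; simp)
  have hvec_x (y : ℝ) : (![1, 0, y, 0] + Pi.single 1 1 : Fin 4 → ℝ) = ![1, 1, y, 0] := by
    ext i; fin_cases i <;> simp
  have hvec_y (x : ℝ) : (![1, x, 0, 0] + Pi.single 2 1 : Fin 4 → ℝ) = ![1, x, 1, 0] := by
    ext i; fin_cases i <;> simp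
  simp only [hvec_x] at hstep_x
  simp only [hvec_y] at hstep_y
  apply hμ
  linarith [hstep_x 0, hstep_x 1, hstep_y 0, hstep_y 1]
end

section
/- Let μ be a real constant. Define f, g : {Q ∈ ℝ⁴ : Q₁ > 0} → ℝ by f(Q) = −(μ/3)·Q₂Q₃/Q₁³ (the (1,2) entry of the energy-equation diffusion matrix A41) and g(Q) = μ·Q₃/Q₁² (the (1,2) entry of A42). Then at every point Q with Q₁ > 0 the partial derivatives satisfy ∂f/∂Q₂(Q) = −μ·Q₃/(3·Q₁³) and ∂g/∂Q₁(Q) = −2μ·Q₃/Q₁³; in particular, if μ ≠ 0 and Q₃ ≠ 0, then ∂f/∂Q₂(Q) ≠ ∂g/∂Q₁(Q), so the mixed-derivative (Clairaut) symmetry required of any matrix antiderivative of the energy-equation diffusion matrices fails on the set {Q : Q₁ > 0, Q₃ ≠ 0}. -/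
/-- Partial derivative of `f : ℝ⁴ → ℝ` at `Q` in the `k`-th coordinate direction. -/
noncomputable def pd4 (f : (Fin 4 → ℝ) → ℝ) (Q : Fin 4 → ℝ) (k : Fin 4) : ℝ :=
  fderiv ℝ f Q (Pi.single k 1)

/-- The (1,2) entry of `A41` in the conserved variables `Q` (for `Q₁ > 0`). -/
noncomputable def A41entry12 (μ : ℝ) (Q : Fin 4 → ℝ) : ℝ :=
  -(μ / 3) * (Q 1 * Q 2) / (Q 0) ^ 3

/-- The (1,2) entry of `A42` in the conserved variables `Q` (for `Q₁ > 0`). -/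
noncomputable def A42entry12 (μ : ℝ) (Q : Fin 4 → ℝ) : ℝ :=
  μ * Q 2 / (Q 0) ^ 2

/-- The partial derivative of a differentiable function is the derivative along the
corresponding coordinate line. -/
theorem pd4_eq_of_hasDerivAt_update {f : (Fin 4 → ℝ) → ℝ} {Q : Fin 4 → ℝ} {k : Fin 4} {d : ℝ}
    (hf : DifferentiableAt ℝ f Q)
    (hd : HasDerivAt (fun t => f (Function.update Q k t)) d (Q k)) : pd4 f Q k = d := by
  have hf' : HasFDerivAt f (fderiv ℝ f Q) (Function.update Q k (Q k)) := by
    simpa using hf.hasFDerivAt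
  exact (hf'.comp_hasDerivAt (Q k) (hasDerivAt_update Q k (Q k))).unique hd

theorem pd4_A41entry12 (μ : ℝ) {Q : Fin 4 → ℝ} (hQ : Q 0 ≠ 0) :
    pd4 (A41entry12 μ) Q 1 = -(μ * Q 2) / (3 * (Q 0) ^ 3) := by
  apply pd4_eq_of_hasDerivAt_update
  · unfold A41entry12
    fun_prop (disch := positivity)
  · have h := (((hasDerivAt_id (Q 1)).mul_const (Q 2)).const_mul (-(μ / 3))).div_const (Q 0 ^ 3)
    refine HasDerivAt.congr_deriv h ?_
    field_simp

theorem pd4_A42entry12 (μ : ℝ) {Q : Fin 4 → ℝ} (hQ : Q 0 ≠ 0) :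
    pd4 (A42entry12 μ) Q 0 = -(2 * μ * Q 2) / (Q 0) ^ 3 := by
  apply pd4_eq_of_hasDerivAt_update
  · unfold A42entry12
    fun_prop (disch := positivity)
  · have h := (hasDerivAt_const (Q 0) (μ * Q 2)).fun_div (hasDerivAt_pow 2 (Q 0))
      (pow_ne_zero 2 hQ)
    refine HasDerivAt.congr_deriv h ?_
    field_simp
    ring

/-- With `f` the (1,2) entry of `A41` and `g` the (1,2) entry of `A42`, one has
`∂f/∂Q₂ = −μQ₃/(3Q₁³)` and `∂g/∂Q₁ = −2μQ₃/Q₁³` at every `Q` with `Q₁ > 0`; in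
particular, if `μ ≠ 0` and `Q₃ ≠ 0` then `∂f/∂Q₂ ≠ ∂g/∂Q₁`, so the mixed-derivative
(Clairaut) symmetry required of any matrix antiderivative of the energy-equation
diffusion matrices fails. -/
theorem energy_mixed_derivative_symmetry_fails (μ : ℝ) :
    ∀ Q : Fin 4 → ℝ, Q 0 > 0 →
      pd4 (A41entry12 μ) Q 1 = -(μ * Q 2) / (3 * (Q 0) ^ 3) ∧
      pd4 (A42entry12 μ) Q 0 = -(2 * μ * Q 2) / (Q 0) ^ 3 ∧
      (μ ≠ 0 → Q 2 ≠ 0 → pd4 (A41entry12 μ) Q 1 ≠ pd4 (A42entry12 μ) Q 0) := by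
  intro Q hQ
  have hQ0 : Q 0 ≠ 0 := hQ.ne'
  refine ⟨pd4_A41entry12 μ hQ0, pd4_A42entry12 μ hQ0, fun hμ hQ2 h => ?_⟩
  rw [pd4_A41entry12 μ hQ0, pd4_A42entry12 μ hQ0] at h
  field_simp at h
  norm_num at h
end
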